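/- Fix s ∈ [0,1] with s ≠ 1/2. Let μ_1 < … < μ_d be real numbers with μ_j > 1, and suppose Φ is the completely positive map on M_N(ℂ) given by Φ(A) = Σ_{j=1}^d Σ_{k=1}^{M_j} ( μ_j^{1/2} V_k^{(j)*} A V_k^{(j)} + μ_j^{−1/2} V_k^{(j)} A V_k^{(j)*} ), where for each j the matrices V_k^{(j)} satisfy σ V_k^{(j)} σ^{−1} = μ_j V_k^{(j)} and the whole family { V_k^{(j)} } is linearly independent. Then a completely positive map Ψ that is self-adjoint with respect to ⟨B,A⟩_{δ_s} = Tr[B* σ^s A σ^{1−s}] satisfies that Φ − Ψ is completely positive if and only if there exist matrices T^{(1)},…,T^{(d)}, with T^{(j)} an M_j×M_j self-adjoint matrix satisfying 0 ≤ T^{(j)} ≤ 1, such that Ψ(A) = Σ_{j=1}^d Σ_{k,ℓ=1}^{M_j} T^{(j)}_{k,ℓ} ( μ_j^{1/2} V_k^{(j)*} A V_ℓ^{(j)} + μ_j^{−1/2} V_ℓ^{(j)} A V_k^{(j)*} ). -/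

import Mathlib

open MeasureTheory Matrix
open scoped ComplexOrder

noncomputable section

/-- The algebra of `N × N` complex matrices. -/
abbrev Mat (N : ℕ) := Matrix (Fin N) (Fin N) ℂ

variable {N : ℕ}

/-- Real power `σ^s` of a positive definite matrix, defined via the spectral decomposition. -/
noncomputable def mpow (σ : Mat N) (hσ : σ.PosDef) (s : ℝ) : Mat N :=
  (hσ.1.eigenvectorUnitary : Mat N) *
    Matrix.diagonal (fun i => ((hσ.1.eigenvalues i ^ s : ℝ) : ℂ)) *
    star (hσ.1.eigenvectorUnitary : Mat N)

/-- Complete positivity of a linear map on `M_N(ℂ)`: existence of a Kraus representation. -/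
def IsCP (Φ : Mat N →ₗ[ℂ] Mat N) : Prop :=
  ∃ (M : ℕ) (V : Fin M → Mat N), ∀ A, Φ A = ∑ j, (V j)ᴴ * A * V j

/-- The KMS inner product `⟨B,A⟩_KMS = Tr[Bᴴ σ^{1/2} A σ^{1/2}]`. -/
def kmsInner (σ : Mat N) (hσ : σ.PosDef) (B A : Mat N) : ℂ :=
  (Bᴴ * mpow σ hσ (1/2) * A * mpow σ hσ (1/2)).trace

/-- Self-adjointness with respect to the KMS inner product. -/
def IsKMSSelfAdjoint (σ : Mat N) (hσ : σ.PosDef) (Φ : Mat N →ₗ[ℂ] Mat N) : Prop :=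
  ∀ A B, kmsInner σ hσ B (Φ A) = kmsInner σ hσ (Φ B) A

/-- The inner product `⟨B,A⟩_{δ_s} = Tr[Bᴴ σ^s A σ^{1-s}]`. -/
def dsInner (σ : Mat N) (hσ : σ.PosDef) (s : ℝ) (B A : Mat N) : ℂ :=
  (Bᴴ * mpow σ hσ s * A * mpow σ hσ (1 - s)).trace

/-- Self-adjointness with respect to `⟨·,·⟩_{δ_s}`. -/
def IsDsSelfAdjoint (σ : Mat N) (hσ : σ.PosDef) (s : ℝ) (Φ : Mat N →ₗ[ℂ] Mat N) : Prop :=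
  ∀ A B, dsInner σ hσ s B (Φ A) = dsInner σ hσ s (Φ B) A


/-- Flattening of a family of matrices. -/
def flat {ι : Type*} (X : ι → Mat N) : Matrix ι (Fin N × Fin N) ℂ :=
  Matrix.of fun p ia => X p ia.1 ia.2

/-- Choi matrix. -/
def choi (Φ : Mat N →ₗ[ℂ] Mat N) : Matrix (Fin N × Fin N) (Fin N × Fin N) ℂ :=
  Matrix.of fun ia jb => Φ (Matrix.single ia.1 jb.1 1) ia.2 jb.2

/-- The map with coefficient matrix `C`. -/
def kmap {ι : Type*} [Fintype ι] (X : ι → Mat N) (C : Matrix ι ι ℂ) : Mat N →ₗ[ℂ] Mat N :=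
  ∑ p, ∑ q, C p q • ((LinearMap.mulRight ℂ (X q)).comp (LinearMap.mulLeft ℂ (X p)ᴴ))

lemma kmap_apply {ι : Type*} [Fintype ι] (X : ι → Mat N) (C : Matrix ι ι ℂ) (A : Mat N) :
    kmap X C A = ∑ p, ∑ q, C p q • ((X p)ᴴ * A * X q) := by
  simp [kmap, LinearMap.sum_apply]

lemma choi_kmap {ι : Type*} [Fintype ι] (X : ι → Mat N) (C : Matrix ι ι ℂ) :
    choi (kmap X C) = (flat X)ᴴ * C * flat X := by
  ext ⟨i, a⟩ ⟨j, b⟩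
  have h : ∀ p q : ι, ((X p)ᴴ * Matrix.single i j (1:ℂ) * X q) a b = star (X p i a) * X q j b := by
    intro p q
    rw [Matrix.mul_assoc, Matrix.mul_apply, Finset.sum_eq_single i]
    · simp
    · intro k _ hk
      rw [Matrix.single_mul_apply_of_ne _ _ _ _ _ hk, mul_zero]
    · simp
  simp only [choi, Matrix.of_apply, kmap_apply, Matrix.sum_apply, Matrix.smul_apply, h]
  simp only [Matrix.mul_apply, Matrix.of_apply, flat, Matrix.conjTranspose_apply, smul_eq_mul, Finset.sum_mul]
  rw [Finset.sum_comm]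
  refine Finset.sum_congr rfl fun q _ => Finset.sum_congr rfl fun p _ => ?_
  ring

lemma choi_inj {Φ Ψ : Mat N →ₗ[ℂ] Mat N} (h : choi Φ = choi Ψ) : Φ = Ψ := by
  refine Matrix.ext_linearMap ℂ fun i j => ?_
  ext a b
  exact congrFun (congrFun h (i, a)) (j, b)

lemma choi_sub (Φ Ψ : Mat N →ₗ[ℂ] Mat N) : choi (Φ - Ψ) = choi Φ - choi Ψ := by
  ext; simp [choi]

lemma psd_factor {n : Type*} [Fintype n] [DecidableEq n] {A : Matrix n n ℂ} (hA : A.PosSemidef) :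
    ∃ B : Matrix n n ℂ, A = Bᴴ * B := by
  open scoped MatrixOrder in
  exact CStarAlgebra.nonneg_iff_eq_star_mul_self.mp (Matrix.nonneg_iff_posSemidef.mpr hA)

lemma isCP_of_kraus {ι : Type*} [Fintype ι] {Φ : Mat N →ₗ[ℂ] Mat N} (X : ι → Mat N)
    (h : ∀ A, Φ A = ∑ p, (X p)ᴴ * A * X p) : IsCP Φ := by
  refine ⟨Fintype.card ι, fun i => X ((Fintype.equivFin ι).symm i), fun A => ?_⟩
  rw [h, ← Equiv.sum_comp (Fintype.equivFin ι).symm]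

lemma kmap_one {ι : Type*} [Fintype ι] [DecidableEq ι] (X : ι → Mat N) (A : Mat N) :
    kmap X 1 A = ∑ p, (X p)ᴴ * A * X p := by
  rw [kmap_apply]
  simp [Matrix.one_apply, ite_smul]

lemma isCP_iff (Φ : Mat N →ₗ[ℂ] Mat N) : IsCP Φ ↔ (choi Φ).PosSemidef := by
  constructor
  · rintro ⟨M, V, h⟩
    have : Φ = kmap V 1 := by
      ext1 A; rw [h, kmap_one]
    rw [this, choi_kmap]
    exact Matrix.PosSemidef.one.conjTranspose_mul_mul_same _
  · intro h
    obtain ⟨B, hB⟩ := psd_factor h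
    refine isCP_of_kraus (fun p => Matrix.of fun i a => B p (i, a)) fun A => ?_
    rw [← kmap_one]
    congr 1
    apply choi_inj
    rw [choi_kmap, hB, Matrix.mul_one]
    rfl

lemma exists_right_inv {ι : Type*} [Fintype ι] [DecidableEq ι] (X : ι → Mat N)
    (h : LinearIndependent ℂ X) : ∃ Y : Matrix (Fin N × Fin N) ι ℂ, flat X * Y = (1 : Matrix ι ι ℂ) := by
  have h1 : LinearIndependent ℂ (flat X).row := by
    rw [Fintype.linearIndependent_iff] at h ⊢
    intro g hg
    apply h g
    ext i a
    have := congrFun hg (i, a)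
    simpa [Matrix.sum_apply, flat, Matrix.row] using this
  have h2 : Function.Injective (flat X).vecMulLinear := by
    rw [← Matrix.vecMul_injective_iff] at h1; exact h1
  obtain ⟨g, hg⟩ := LinearMap.exists_leftInverse_of_injective _ (LinearMap.ker_eq_bot.mpr h2)
  refine ⟨(LinearMap.toMatrix' g)ᵀ, ?_⟩
  rw [← Matrix.transpose_inj, Matrix.transpose_mul, Matrix.transpose_transpose, Matrix.transpose_one]
  have h3 : LinearMap.toMatrix' (flat X).vecMulLinear = (flat X)ᵀ := by
    ext i j
    simp [LinearMap.toMatrix'_apply, Matrix.vecMulLinear]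
  rw [← h3, ← LinearMap.toMatrix'_comp, hg, LinearMap.toMatrix'_id]

lemma choi_coef {ι : Type*} [Fintype ι] [DecidableEq ι] {X : ι → Mat N} {Y : Matrix (Fin N × Fin N) ι ℂ}
    (hY : flat X * Y = (1 : Matrix ι ι ℂ)) (C : Matrix ι ι ℂ) : Yᴴ * choi (kmap X C) * Y = C := by
  have : Yᴴ * (flat X)ᴴ = 1 := by
    rw [← Matrix.conjTranspose_mul, hY, Matrix.conjTranspose_one]
  rw [choi_kmap, ← Matrix.mul_assoc, ← Matrix.mul_assoc, this, Matrix.one_mul, Matrix.mul_assoc, hY,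
    Matrix.mul_one]

lemma kmap_inj {ι : Type*} [Fintype ι] [DecidableEq ι] {X : ι → Mat N} {Y : Matrix (Fin N × Fin N) ι ℂ}
    (hY : flat X * Y = (1 : Matrix ι ι ℂ)) {C D : Matrix ι ι ℂ} (h : kmap X C = kmap X D) : C = D := by
  rw [← choi_coef hY C, h, choi_coef hY D]

lemma radon {ι : Type*} [Fintype ι] [DecidableEq ι] {X : ι → Mat N} {Y : Matrix (Fin N × Fin N) ι ℂ}
    (hY : flat X * Y = (1 : Matrix ι ι ℂ)) (D : Matrix ι ι ℂ) {Ψ : Mat N →ₗ[ℂ] Mat N}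
    (h1 : IsCP Ψ) (h2 : IsCP (kmap X D - Ψ)) :
    ∃ C : Matrix ι ι ℂ, Ψ = kmap X C ∧ C.PosSemidef ∧ (D - C).PosSemidef := by
  rw [isCP_iff] at h1 h2
  rw [choi_sub] at h2
  set K := choi Ψ with hK
  have key : K * (1 - Y * flat X) = 0 := by
    rw [← Matrix.mulVec_injective.eq_iff]
    funext v
    rw [← Matrix.mulVec_mulVec, Matrix.zero_mulVec]
    set w := (1 - Y * flat X) *ᵥ v with hw
    have hX : flat X *ᵥ w = 0 := by
      rw [hw, Matrix.mulVec_mulVec, Matrix.mul_sub, Matrix.mul_one, ← Matrix.mul_assoc, hY,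
        Matrix.one_mul, sub_self, Matrix.zero_mulVec]
    rw [← h1.dotProduct_mulVec_zero_iff]
    apply le_antisymm _ (h1.dotProduct_mulVec_nonneg w)
    have := h2.dotProduct_mulVec_nonneg w
    rw [choi_kmap, Matrix.sub_mulVec, ← Matrix.mulVec_mulVec, hX, Matrix.mulVec_zero, zero_sub,
      dotProduct_neg] at this
    exact neg_nonneg.mp this
  have k1 : K = K * (Y * flat X) := by
    rw [Matrix.mul_sub, Matrix.mul_one, sub_eq_zero] at key; exact key
  have k2 : K = (Y * flat X)ᴴ * K := by
    have := congrArg Matrix.conjTranspose k1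
    rwa [Matrix.conjTranspose_mul, h1.1.eq] at this
  refine ⟨Yᴴ * K * Y, ?_, h1.conjTranspose_mul_mul_same _, ?_⟩
  · apply choi_inj
    rw [choi_kmap, ← hK]
    conv_lhs => rw [k1, k2]
    simp only [Matrix.conjTranspose_mul, Matrix.mul_assoc]
  · have := h2.conjTranspose_mul_mul_same Y
    rwa [Matrix.mul_sub, Matrix.sub_mul, choi_coef hY] at this

section mpow
variable (σ : Mat N) (hσ : σ.PosDef)

/-- Conjugation into the eigenbasis. -/
def hat (X : Mat N) : Mat N :=
  star (hσ.1.eigenvectorUnitary : Mat N) * X * (hσ.1.eigenvectorUnitary : Mat N)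

lemma UsU : (hσ.1.eigenvectorUnitary : Mat N) * star (hσ.1.eigenvectorUnitary : Mat N) = 1 :=
  Unitary.coe_mul_star_self _

lemma sUU : star (hσ.1.eigenvectorUnitary : Mat N) * (hσ.1.eigenvectorUnitary : Mat N) = 1 :=
  Unitary.coe_star_mul_self _

lemma hat_mul (X Y : Mat N) : hat σ hσ (X * Y) = hat σ hσ X * hat σ hσ Y := by
  unfold hat
  calc _ = star (hσ.1.eigenvectorUnitary : Mat N) * X * 1 * Y *
        (hσ.1.eigenvectorUnitary : Mat N) := by simp only [Matrix.mul_assoc, Matrix.one_mul]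
    _ = _ := by rw [← UsU σ hσ]; simp only [Matrix.mul_assoc]

lemma hat_inj {X Y : Mat N} (h : hat σ hσ X = hat σ hσ Y) : X = Y := by
  have : ∀ Z : Mat N, Z = (hσ.1.eigenvectorUnitary : Mat N) * hat σ hσ Z *
      star (hσ.1.eigenvectorUnitary : Mat N) := by
    intro Z
    unfold hat
    calc Z = 1 * Z * 1 := by simp
      _ = _ := by rw [← UsU σ hσ]; simp only [Matrix.mul_assoc]
  rw [this X, h, ← this Y]

lemma hat_mpow (s : ℝ) : hat σ hσ (mpow σ hσ s) =
    Matrix.diagonal (fun i => ((hσ.1.eigenvalues i ^ s : ℝ) : ℂ)) := by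
  unfold hat mpow
  set U := (hσ.1.eigenvectorUnitary : Mat N) with hU
  have h := sUU σ hσ
  rw [← hU] at h
  set D := Matrix.diagonal (fun i => ((hσ.1.eigenvalues i ^ s : ℝ) : ℂ))
  calc _ = (star U * U) * D * (star U * U) := by simp only [Matrix.mul_assoc]
    _ = _ := by rw [h]; simp

lemma mpow_one : mpow σ hσ 1 = σ := by
  have h := hσ.1.spectral_theorem
  rw [Unitary.conjStarAlgAut_apply] at h
  conv_rhs => rw [h]
  unfold mpow
  congr 2
  simp only [Real.rpow_one]
  rfl

lemma hat_smul (c : ℂ) (X : Mat N) : hat σ hσ (c • X) = c • hat σ hσ X := by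
  simp [hat]

lemma hat_entry {X : Mat N} {l : ℝ} (h : σ * X * σ⁻¹ = (l : ℂ) • X) (a b : Fin N)
    (hne : hat σ hσ X a b ≠ 0) : hσ.1.eigenvalues a = l * hσ.1.eigenvalues b := by
  have h1 : σ * X = (l : ℂ) • (X * σ) := by
    rw [← Matrix.smul_mul, ← h, Matrix.mul_assoc, Matrix.nonsing_inv_mul, Matrix.mul_one]
    exact (Matrix.isUnit_iff_isUnit_det _).mp hσ.isUnit
  have h2 := congrArg (hat σ hσ) h1
  rw [hat_smul, hat_mul, hat_mul] at h2
  have h3 : hat σ hσ σ = Matrix.diagonal (fun i => ((hσ.1.eigenvalues i : ℝ) : ℂ)) := by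
    have h4 := hat_mpow σ hσ 1
    rw [mpow_one] at h4
    simpa using h4
  rw [h3] at h2
  have h5 := congrFun (congrFun h2 a) b
  rw [Matrix.smul_apply, Matrix.mul_diagonal, Matrix.diagonal_mul, smul_eq_mul] at h5
  have h6 : ((hσ.1.eigenvalues a : ℝ) : ℂ) = l * (hσ.1.eigenvalues b : ℝ) := by
    apply mul_right_cancel₀ hne
    rw [h5]; ring
  exact_mod_cast h6

lemma mpow_comm {X : Mat N} {l : ℝ} (hl : 0 < l) (h : σ * X * σ⁻¹ = (l : ℂ) • X) (s : ℝ) :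
    X * mpow σ hσ s = ((l ^ (-s) : ℝ) : ℂ) • (mpow σ hσ s * X) := by
  apply hat_inj σ hσ
  rw [hat_smul, hat_mul, hat_mul, hat_mpow]
  ext a b
  rw [Matrix.mul_diagonal, Matrix.smul_apply, Matrix.diagonal_mul, smul_eq_mul]
  by_cases hz : hat σ hσ X a b = 0
  · simp [hz]
  · rw [hat_entry σ hσ h a b hz, Real.mul_rpow hl.le (hσ.eigenvalues_pos b).le, Real.rpow_neg hl.le]
    have : ((l ^ s : ℝ) : ℂ) ≠ 0 := by
      exact_mod_cast (Real.rpow_pos_of_pos hl s).ne'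
    push_cast
    field_simp

lemma mpow_mul_neg (s : ℝ) : mpow σ hσ s * mpow σ hσ (-s) = 1 := by
  apply hat_inj σ hσ
  rw [hat_mul, hat_mpow, hat_mpow, Matrix.diagonal_mul_diagonal]
  have : hat σ hσ 1 = 1 := by simp [hat]
  rw [this, ← Matrix.diagonal_one]
  congr 1
  funext i
  have h := hσ.eigenvalues_pos i
  rw [← Complex.ofReal_mul, ← Real.rpow_add h]
  simp

lemma trace_ext {s : ℝ} {P Q : Mat N}
    (h : ∀ B : Mat N, (Bᴴ * mpow σ hσ s * P * mpow σ hσ (1 - s)).trace =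
      (Bᴴ * mpow σ hσ s * Q * mpow σ hσ (1 - s)).trace) : P = Q := by
  rw [Matrix.ext_iff_trace_mul_left]
  intro R
  have h' := h (mpow σ hσ (-(1 - s)) * R * mpow σ hσ (-s))ᴴ
  have e1 := mpow_mul_neg σ hσ (-s)
  rw [neg_neg] at e1
  have e2 := mpow_mul_neg σ hσ (1 - s)
  have key : ∀ P : Mat N, ((mpow σ hσ (-(1 - s)) * R * mpow σ hσ (-s))ᴴᴴ * mpow σ hσ s * P *
      mpow σ hσ (1 - s)).trace = (R * P).trace := by
    intro P
    rw [Matrix.trace_mul_comm, Matrix.conjTranspose_conjTranspose]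
    congr 1
    calc _ = (mpow σ hσ (1 - s) * mpow σ hσ (-(1 - s))) * R *
          (mpow σ hσ (-s) * mpow σ hσ s) * P := by simp only [Matrix.mul_assoc]
      _ = _ := by rw [e1, e2]; simp
  rwa [key, key] at h'

lemma trace_aux {S T P Q A B : Mat N} {c d : ℂ} (h1 : P * S = c • (S * P))
    (h2 : T * Q = d • (Q * T)) :
    (Q * B * P * S * A * T).trace = c * d * (B * S * (P * A * Q) * T).trace := by
  have e : (Q * B * P * S * A * T).trace = (B * (P * S) * A * (T * Q)).trace := by
    rw [Matrix.mul_assoc Q, Matrix.mul_assoc Q, Matrix.mul_assoc Q, Matrix.mul_assoc Q,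
      Matrix.trace_mul_comm Q]
    simp only [Matrix.mul_assoc]
  rw [e, h1, h2]
  simp only [Matrix.smul_mul, Matrix.mul_smul, Matrix.trace_smul, smul_eq_mul, Matrix.mul_assoc]
  ring

lemma kmap_star {ι : Type*} [Fintype ι] (X : ι → Mat N) {C : Matrix ι ι ℂ} (hC : Cᴴ = C) (B : Mat N) :
    (kmap X C B)ᴴ = kmap X C Bᴴ := by
  rw [kmap_apply, kmap_apply, Finset.sum_comm]
  simp only [Matrix.conjTranspose_sum, Matrix.conjTranspose_smul, Matrix.conjTranspose_mul,
    Matrix.conjTranspose_conjTranspose, Matrix.mul_assoc]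
  refine Finset.sum_congr rfl fun p _ => Finset.sum_congr rfl fun q _ => ?_
  rw [← Matrix.conjTranspose_apply, hC]


lemma coef_symm_aux {ι : Type*} [Fintype ι] (X : ι → Mat N) (C : Matrix ι ι ℂ) (τ : ι ≃ ι)
    (f : ι → ι → ℂ) (S T A B : Mat N)
    (h : ∀ p q, ((X (τ q))ᴴ * B * X (τ p) * S * A * T).trace =
      f p q * (B * S * ((X p)ᴴ * A * X q) * T).trace) :
    (kmap X C B * S * A * T).trace =
      (B * S * kmap X (Matrix.of fun a b => C (τ b) (τ a) * f a b) A * T).trace := by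
  rw [kmap_apply, kmap_apply]
  simp only [Matrix.sum_mul, Matrix.mul_sum, Matrix.trace_sum, Matrix.smul_mul, Matrix.mul_smul,
    Matrix.trace_smul, Matrix.of_apply]
  rw [Finset.sum_comm, ← Equiv.sum_comp τ]
  refine Finset.sum_congr rfl fun p _ => ?_
  rw [← Equiv.sum_comp τ]
  refine Finset.sum_congr rfl fun q _ => ?_
  rw [smul_eq_mul, smul_eq_mul, h]
  ring

/-- Key symmetry of the coefficients coming from self-adjointness. -/
lemma coef_symm {ι : Type*} [Fintype ι] [DecidableEq ι] {X : ι → Mat N}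
    {Y : Matrix (Fin N × Fin N) ι ℂ}
    (hY : flat X * Y = (1 : Matrix ι ι ℂ)) (τ : ι ≃ ι) (hτ : ∀ p, τ (τ p) = p)
    (hX : ∀ p, X (τ p) = (X p)ᴴ) (l : ι → ℝ) (hl : ∀ p, 0 < l p) (hlτ : ∀ p, l (τ p) = (l p)⁻¹)
    (heig : ∀ p, σ * X p * σ⁻¹ = (l p : ℂ) • X p) (s : ℝ) (C : Matrix ι ι ℂ) (hC : Cᴴ = C)
    (hsa : IsDsSelfAdjoint σ hσ s (kmap X C)) (a b : ι) :
    C a b = C (τ b) (τ a) * ((l a ^ s * l b ^ (1 - s) : ℝ) : ℂ) := by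
  suffices h : kmap X C = kmap X (Matrix.of fun a b =>
      C (τ b) (τ a) * ((l a ^ s * l b ^ (1 - s) : ℝ) : ℂ)) from
    congrFun (congrFun (kmap_inj hY h) a) b
  ext1 A
  apply trace_ext σ hσ (s := s)
  intro B
  have h1 := hsa A B
  unfold dsInner at h1
  rw [h1]
  have h2 := kmap_star X hC B
  rw [h2]
  apply coef_symm_aux
  intro p q
  have e1 := mpow_comm σ hσ (hl (τ p)) (heig (τ p)) s
  have e2 := mpow_comm σ hσ (hl q) (heig q) (1 - s)
  have e3 : mpow σ hσ (1 - s) * X q = ((l q ^ (1 - s) : ℝ) : ℂ) • (X q * mpow σ hσ (1 - s)) := by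
    rw [e2, smul_smul, ← Complex.ofReal_mul, ← Real.rpow_add (hl q)]
    simp
  have e4 : (l (τ p)) ^ (-s) = l p ^ s := by
    rw [hlτ, Real.inv_rpow (hl p).le, Real.rpow_neg (hl p).le, inv_inv]
  rw [e4] at e1
  have hXq : (X (τ q))ᴴ = X q := by rw [← hX, hτ]
  rw [hXq, ← hX p]
  rw [trace_aux e1 e3]
  push_cast
  ring

lemma coef_zero {ι : Type*} (τ : ι ≃ ι) (hτ : ∀ p, τ (τ p) = p)
    (l : ι → ℝ) (hl : ∀ p, 0 < l p) (hlτ : ∀ p, l (τ p) = (l p)⁻¹) (s : ℝ) (hs : s ≠ 1 / 2)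
    (C : Matrix ι ι ℂ) 
    (h : ∀ a b, C a b = C (τ b) (τ a) * ((l a ^ s * l b ^ (1 - s) : ℝ) : ℂ))
    (a b : ι) (hab : l a ≠ l b) : C a b = 0 := by
  have h1 := h a b
  rw [h (τ b) (τ a), hτ, hτ, hlτ, hlτ, mul_assoc, ← Complex.ofReal_mul] at h1
  by_contra hne
  have h2 : (((l b)⁻¹ ^ s * (l a)⁻¹ ^ (1 - s) * (l a ^ s * l b ^ (1 - s)) : ℝ) : ℂ) = 1 := by
    have : C a b * 1 = C a b * (((l b)⁻¹ ^ s * (l a)⁻¹ ^ (1 - s) * (l a ^ s * l b ^ (1 - s)) : ℝ) : ℂ) := by rw [mul_one]; exact h1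
    exact (mul_left_cancel₀ hne this).symm
  have h3 : (l b)⁻¹ ^ s * (l a)⁻¹ ^ (1 - s) * (l a ^ s * l b ^ (1 - s)) = 1 := by exact_mod_cast h2
  have h4 := congrArg Real.log h3
  have pa := hl a
  have pb := hl b
  rw [Real.log_mul (by positivity) (by positivity), Real.log_mul (by positivity) (by positivity),
    Real.log_mul (by positivity) (by positivity), Real.log_rpow (by positivity),
    Real.log_rpow (by positivity), Real.log_rpow (by positivity), Real.log_rpow (by positivity),
    Real.log_inv, Real.log_inv, Real.log_one] at h4
  have h5 : (1 - 2 * s) * (Real.log (l b) - Real.log (l a)) = 0 := by linarith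
  rcases mul_eq_zero.mp h5 with h6 | h6
  · apply hs; linarith
  · exact hab (Real.log_injOn_pos pa pb (by linarith))

end mpow

section main
variable {d : ℕ} {Mj : Fin d → ℕ}

/-- Index type. -/
abbrev Idx (Mj : Fin d → ℕ) := (Σ j : Fin d, Fin (Mj j)) ⊕ (Σ j : Fin d, Fin (Mj j))

/-- The Kraus family together with the adjoints. -/
def XX (V : (j : Fin d) → Fin (Mj j) → Mat N) : Idx Mj → Mat N :=
  Sum.elim (fun p => V p.1 p.2) (fun p => (V p.1 p.2)ᴴ)

/-- Modular eigenvalues. -/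
def LL (Mj : Fin d → ℕ) (μ : Fin d → ℝ) : Idx Mj → ℝ :=
  Sum.elim (fun p => μ p.1) (fun p => (μ p.1)⁻¹)

/-- Block coefficient matrix built from `T`. -/
def CC (μ : Fin d → ℝ) (T : (j : Fin d) → Matrix (Fin (Mj j)) (Fin (Mj j)) ℂ) :
    Matrix (Idx Mj) (Idx Mj) ℂ :=
  Matrix.fromBlocks (Matrix.blockDiagonal' fun j => (Real.sqrt (μ j) : ℂ) • T j) 0 0
    (Matrix.blockDiagonal' fun j => ((Real.sqrt (μ j))⁻¹ : ℂ) • (T j)ᵀ)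

lemma sum_block {E : Type*} [AddCommMonoid E] [Module ℂ E]
    (T : (j : Fin d) → Matrix (Fin (Mj j)) (Fin (Mj j)) ℂ)
    (F : (Σ j : Fin d, Fin (Mj j)) → (Σ j : Fin d, Fin (Mj j)) → E) :
    ∑ p, ∑ q, Matrix.blockDiagonal' T p q • F p q =
      ∑ j, ∑ k, ∑ l, T j k l • F ⟨j, k⟩ ⟨j, l⟩ := by
  rw [Fintype.sum_sigma]
  refine Finset.sum_congr rfl fun j _ => Finset.sum_congr rfl fun k _ => ?_
  rw [Fintype.sum_sigma, Finset.sum_eq_single j]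
  · simp
  · intro i _ hi
    refine Finset.sum_eq_zero fun l _ => ?_
    rw [Matrix.blockDiagonal'_apply_ne _ _ _ hi.symm, zero_smul]
  · simp

lemma kmap_CC (V : (j : Fin d) → Fin (Mj j) → Mat N) (μ : Fin d → ℝ)
    (T : (j : Fin d) → Matrix (Fin (Mj j)) (Fin (Mj j)) ℂ) (A : Mat N) :
    kmap (XX V) (CC μ T) A = ∑ j, ∑ k, ∑ l, T j k l •
          ((Real.sqrt (μ j) : ℂ) • ((V j k)ᴴ * A * V j l) +
            ((Real.sqrt (μ j))⁻¹ : ℂ) • (V j l * A * (V j k)ᴴ)) := by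
  rw [kmap_apply]
  simp only [Fintype.sum_sum_type, CC, XX, Matrix.fromBlocks_apply₁₁, Matrix.fromBlocks_apply₁₂,
    Matrix.fromBlocks_apply₂₁, Matrix.fromBlocks_apply₂₂, Matrix.zero_apply, zero_smul,
    Finset.sum_const_zero, add_zero, zero_add, Sum.elim_inl, Sum.elim_inr,
    Matrix.conjTranspose_conjTranspose]
  rw [sum_block _ (fun p q => (V p.1 p.2)ᴴ * A * V q.1 q.2),
    sum_block _ (fun p q => V p.1 p.2 * A * (V q.1 q.2)ᴴ), ← Finset.sum_add_distrib]
  refine Finset.sum_congr rfl fun j _ => ?_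
  conv_lhs => 
    rhs
    rw [Finset.sum_comm]
  simp only [← Finset.sum_add_distrib]
  refine Finset.sum_congr rfl fun k _ => Finset.sum_congr rfl fun l _ => ?_
  simp only [Matrix.smul_apply, Matrix.transpose_apply, smul_eq_mul, smul_add, smul_smul, mul_comm]

lemma CC_sub (μ : Fin d → ℝ) (T S : (j : Fin d) → Matrix (Fin (Mj j)) (Fin (Mj j)) ℂ) :
    CC μ T - CC μ S = CC μ (fun j => T j - S j) := by
  unfold CC
  rw [sub_eq_add_neg, Matrix.fromBlocks_neg, Matrix.fromBlocks_add, ← sub_eq_add_neg,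
    ← sub_eq_add_neg, ← sub_eq_add_neg, ← Matrix.blockDiagonal'_sub, ← Matrix.blockDiagonal'_sub]
  congr 1 <;> simp [Pi.sub_def, smul_sub]

lemma psd_blockDiagonal' {T : (j : Fin d) → Matrix (Fin (Mj j)) (Fin (Mj j)) ℂ}
    (h : ∀ j, (T j).PosSemidef) : (Matrix.blockDiagonal' T).PosSemidef := by
  choose B hB using fun j => psd_factor (h j)
  have : Matrix.blockDiagonal' T = (Matrix.blockDiagonal' B)ᴴ * Matrix.blockDiagonal' B := by
    rw [Matrix.blockDiagonal'_conjTranspose, ← Matrix.blockDiagonal'_mul]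
    congr 1
    funext j
    exact hB j
  rw [this]
  exact Matrix.posSemidef_conjTranspose_mul_self _

lemma psd_fromBlocks {m n : Type*} [Fintype m] [Fintype n] [DecidableEq m] [DecidableEq n]
    {A : Matrix m m ℂ} {D : Matrix n n ℂ} (hA : A.PosSemidef) (hD : D.PosSemidef) :
    (Matrix.fromBlocks A 0 0 D).PosSemidef := by
  obtain ⟨B, hB⟩ := psd_factor hA
  obtain ⟨E, hE⟩ := psd_factor hD
  have : Matrix.fromBlocks A 0 0 D = (Matrix.fromBlocks B 0 0 E)ᴴ * Matrix.fromBlocks B 0 0 E := by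
    rw [Matrix.fromBlocks_conjTranspose, Matrix.fromBlocks_multiply]
    simp [hB, hE]
  rw [this]
  exact Matrix.posSemidef_conjTranspose_mul_self _

lemma CC_psd (μ : Fin d → ℝ) {T : (j : Fin d) → Matrix (Fin (Mj j)) (Fin (Mj j)) ℂ}
    (h : ∀ j, (T j).PosSemidef) : (CC μ T).PosSemidef := by
  refine psd_fromBlocks (psd_blockDiagonal' fun j => (h j).smul ?_)
    (psd_blockDiagonal' fun j => (h j).transpose.smul ?_)
  · exact_mod_cast Real.sqrt_nonneg _
  · exact_mod_cast inv_nonneg.mpr (Real.sqrt_nonneg _)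

lemma eig_star {σ X : Mat N} (hσ : σ.PosDef) {l : ℝ} (hl : 0 < l)
    (h : σ * X * σ⁻¹ = (l : ℂ) • X) : σ * Xᴴ * σ⁻¹ = ((l⁻¹ : ℝ) : ℂ) • Xᴴ := by
  have hu : IsUnit σ.det := (Matrix.isUnit_iff_isUnit_det _).mp hσ.isUnit
  have h1 := congrArg Matrix.conjTranspose h
  rw [Matrix.conjTranspose_mul, Matrix.conjTranspose_mul, Matrix.conjTranspose_nonsing_inv,
    hσ.1.eq, Matrix.conjTranspose_smul] at h1
  have h2 : Xᴴ * σ = (l : ℂ) • (σ * Xᴴ) := by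
    have := congrArg (fun Z => σ * Z) h1
    simp only [Matrix.mul_nonsing_inv_cancel_left _ _ hu] at this
    rw [this]
    simp
  have h3 : σ * Xᴴ = ((l⁻¹ : ℝ) : ℂ) • (Xᴴ * σ) := by
    rw [h2, smul_smul, ← Complex.ofReal_mul, inv_mul_cancel₀ hl.ne']
    simp
  rw [h3, Matrix.smul_mul, Matrix.mul_nonsing_inv_cancel_right _ _ hu]

lemma XX_linInd {σ : Mat N} (hσ : σ.PosDef) {μ : Fin d → ℝ} (hμ : ∀ j, 1 < μ j)
    {V : (j : Fin d) → Fin (Mj j) → Mat N}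
    (hlin : LinearIndependent ℂ (fun p : Σ j : Fin d, Fin (Mj j) => V p.1 p.2))
    (heig : ∀ j k, σ * V j k * σ⁻¹ = (μ j : ℂ) • V j k) : LinearIndependent ℂ (XX V) := by
  have hlin' : LinearIndependent ℂ (fun p : Σ j : Fin d, Fin (Mj j) => (V p.1 p.2)ᴴ) := by
    rw [Fintype.linearIndependent_iff] at hlin ⊢
    intro g hg i
    have := hlin (fun p => star (g p)) (by
      have := congrArg Matrix.conjTranspose hg
      simpa [Matrix.conjTranspose_sum] using this) i
    simpa using this
  refine hlin.sum_type hlin' ?_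
  let e := hσ.1.eigenvalues
  let P : Submodule ℂ (Mat N) :=
    { carrier := {X | ∀ a b, e a ≤ e b → hat σ hσ X a b = 0}
      add_mem' := by
        intro X Y hX hY a b hab
        have : hat σ hσ (X + Y) = hat σ hσ X + hat σ hσ Y := by
          simp [hat, Matrix.mul_add, Matrix.add_mul]
        rw [this, Matrix.add_apply, hX a b hab, hY a b hab, add_zero]
      zero_mem' := by intro a b _; simp [hat]
      smul_mem' := by
        intro c X hX a b hab
        rw [hat_smul, Matrix.smul_apply, hX a b hab, smul_zero] }
  let Q : Submodule ℂ (Mat N) :=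
    { carrier := {X | ∀ a b, e b ≤ e a → hat σ hσ X a b = 0}
      add_mem' := by
        intro X Y hX hY a b hab
        have : hat σ hσ (X + Y) = hat σ hσ X + hat σ hσ Y := by
          simp [hat, Matrix.mul_add, Matrix.add_mul]
        rw [this, Matrix.add_apply, hX a b hab, hY a b hab, add_zero]
      zero_mem' := by intro a b _; simp [hat]
      smul_mem' := by
        intro c X hX a b hab
        rw [hat_smul, Matrix.smul_apply, hX a b hab, smul_zero] }
  have hP : Submodule.span ℂ (Set.range fun p : Σ j : Fin d, Fin (Mj j) => V p.1 p.2) ≤ P := by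
    rw [Submodule.span_le]
    rintro _ ⟨p, rfl⟩ a b hab
    by_contra hne
    have h1 := hat_entry σ hσ (heig p.1 p.2) a b hne
    have h2 := hσ.eigenvalues_pos b
    have h3 := hμ p.1
    change hσ.1.eigenvalues a ≤ hσ.1.eigenvalues b at hab
    nlinarith
  have hQ : Submodule.span ℂ (Set.range fun p : Σ j : Fin d, Fin (Mj j) => (V p.1 p.2)ᴴ) ≤ Q := by
    rw [Submodule.span_le]
    rintro _ ⟨p, rfl⟩ a b hab
    by_contra hne
    have h3 := hμ p.1
    have h1 := hat_entry σ hσ (eig_star hσ (by linarith) (heig p.1 p.2)) a b hne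
    have h2 := hσ.eigenvalues_pos b
    have h4 := inv_lt_one_of_one_lt₀ h3
    change hσ.1.eigenvalues b ≤ hσ.1.eigenvalues a at hab
    nlinarith
  refine Disjoint.mono hP hQ ?_
  rw [Submodule.disjoint_def]
  intro X hX1 hX2
  apply hat_inj σ hσ
  ext a b
  have h0 : hat σ hσ 0 a b = 0 := by simp [hat]
  rw [h0]
  rcases le_total (e a) (e b) with h | h
  · exact hX1 a b h
  · exact hX2 a b h

end main

/-- Radon–Nikodym theorem for CP maps self-adjoint with respect to
`⟨·,·⟩_{δ_s}`, `s ≠ 1/2`, with a canonical minimal Kraus representation built from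
eigenvectors of the modular operator with eigenvalues `μ_1 < … < μ_d`, all `> 1`. -/
theorem ds_radon_nikodym (N : ℕ) (hN : 2 ≤ N) (σ : Mat N) (hσ : σ.PosDef)
    (htr : σ.trace = 1) (s : ℝ) (hs : s ∈ Set.Icc (0:ℝ) 1) (hs' : s ≠ 1/2)
    (d : ℕ) (Mj : Fin d → ℕ) (μ : Fin d → ℝ)
    (hmono : StrictMono μ) (hμ : ∀ j, 1 < μ j)
    (V : (j : Fin d) → Fin (Mj j) → Mat N)
    (hlin : LinearIndependent ℂ (fun p : Σ j : Fin d, Fin (Mj j) => V p.1 p.2))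
    (heig : ∀ j k, σ * V j k * σ⁻¹ = (μ j : ℂ) • V j k)
    (Φ : Mat N →ₗ[ℂ] Mat N) (hΦcp : IsCP Φ)
    (hΦ : ∀ A, Φ A = ∑ j, ∑ k, ((Real.sqrt (μ j) : ℂ) • ((V j k)ᴴ * A * V j k) +
        ((Real.sqrt (μ j))⁻¹ : ℂ) • (V j k * A * (V j k)ᴴ)))
    (Ψ : Mat N →ₗ[ℂ] Mat N) (hΨcp : IsCP Ψ) (hΨsa : IsDsSelfAdjoint σ hσ s Ψ) :
    IsCP (Φ - Ψ) ↔
      ∃ T : (j : Fin d) → Matrix (Fin (Mj j)) (Fin (Mj j)) ℂ,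
        (∀ j, (T j).PosSemidef ∧ ((1 : Matrix (Fin (Mj j)) (Fin (Mj j)) ℂ) - T j).PosSemidef) ∧
        ∀ A, Ψ A = ∑ j, ∑ k, ∑ l, T j k l •
          ((Real.sqrt (μ j) : ℂ) • ((V j k)ᴴ * A * V j l) +
            ((Real.sqrt (μ j))⁻¹ : ℂ) • (V j l * A * (V j k)ᴴ)) := by
  have hμ0 : ∀ j, 0 < μ j := fun j => lt_trans one_pos (hμ j)
  have hΦ' : Φ = kmap (XX V) (CC μ (fun j => 1)) := by
    ext1 A
    rw [kmap_CC, hΦ]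
    refine Finset.sum_congr rfl fun j _ => Finset.sum_congr rfl fun k _ => ?_
    rw [Finset.sum_eq_single k]
    · simp
    · intro l _ hl
      rw [Matrix.one_apply_ne hl.symm, zero_smul]
    · simp
  constructor
  · intro hcp
    obtain ⟨Y, hY⟩ := exists_right_inv (XX V) (XX_linInd hσ hμ hlin heig)
    rw [hΦ'] at hcp
    obtain ⟨C, hC, hC0, hC1⟩ := radon hY _ hΨcp hcp
    rw [hC] at hΨsa
    have hl : ∀ p, 0 < LL Mj μ p := by
      rintro (p | p)
      · exact hμ0 p.1
      · exact inv_pos.mpr (hμ0 p.1)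
    have hτ : ∀ p : Idx Mj, (Equiv.sumComm _ _) ((Equiv.sumComm _ _) p) = p := by
      rintro (p | p) <;> rfl
    have hlτ : ∀ p : Idx Mj, LL Mj μ ((Equiv.sumComm _ _) p) = (LL Mj μ p)⁻¹ := by
      rintro (p | p)
      · rfl
      · simp [LL]
    have hsymm := coef_symm σ hσ hY (Equiv.sumComm _ _) hτ
      (by
        rintro (p | p)
        · rfl
        · simp [XX]) (LL Mj μ) hl hlτ
      (by
        rintro (p | p)
        · exact heig p.1 p.2
        · exact eig_star hσ (hμ0 p.1) (heig p.1 p.2)) s C hC0.1.eq hΨsa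
    have hzero := coef_zero (Equiv.sumComm _ _) hτ (LL Mj μ) hl hlτ s hs' C hsymm
    let T : (j : Fin d) → Matrix (Fin (Mj j)) (Fin (Mj j)) ℂ := fun j =>
      ((Real.sqrt (μ j))⁻¹ : ℂ) • C.submatrix (fun k => Sum.inl ⟨j, k⟩) (fun k => Sum.inl ⟨j, k⟩)
    have hsq : ∀ j, ((Real.sqrt (μ j) : ℝ) : ℂ) ≠ 0 := fun j => by
      exact_mod_cast (Real.sqrt_pos.mpr (hμ0 j)).ne'
    have hinv : ∀ j, (0 : ℂ) ≤ ((Real.sqrt (μ j))⁻¹ : ℂ) := fun j => by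
      exact_mod_cast inv_nonneg.mpr (Real.sqrt_nonneg _)
    refine ⟨T, fun j => ⟨(hC0.submatrix _).smul (hinv j), ?_⟩, fun A => ?_⟩
    · have h1 := (hC1.submatrix (fun k : Fin (Mj j) => Sum.inl ⟨j, k⟩)).smul (hinv j)
      convert h1 using 1
      ext k l
      simp only [T, CC, Matrix.sub_apply, Matrix.smul_apply, Matrix.submatrix_apply,
        Matrix.fromBlocks_apply₁₁, Matrix.blockDiagonal'_apply_eq, smul_eq_mul, mul_sub]
      rw [inv_mul_cancel_left₀ (hsq j)]
    · rw [← kmap_CC, hC]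
      congr 2
      ext p q
      rcases p with ⟨j, k⟩ | ⟨j, k⟩ <;> rcases q with ⟨i, l⟩ | ⟨i, l⟩
      · by_cases hij : j = i
        · subst hij
          simp only [T, CC, Matrix.fromBlocks_apply₁₁, Matrix.blockDiagonal'_apply_eq,
            Matrix.smul_apply, Matrix.submatrix_apply, smul_eq_mul]
          rw [mul_inv_cancel_left₀ (hsq j)]
        · rw [hzero (Sum.inl ⟨j, k⟩) (Sum.inl ⟨i, l⟩) (fun h => hij (hmono.injective h))]
          simp [CC, Matrix.blockDiagonal'_apply_ne _ _ _ hij]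
      · rw [hzero]
        · simp [CC]
        · have h1 := hμ j
          have h2 := inv_lt_one_of_one_lt₀ (hμ i)
          change μ j ≠ (μ i)⁻¹
          exact (h2.trans h1).ne'
      · rw [hzero]
        · simp [CC]
        · have h1 := hμ i
          have h2 := inv_lt_one_of_one_lt₀ (hμ j)
          change (μ j)⁻¹ ≠ μ i
          exact (h2.trans h1).ne
      · by_cases hij : j = i
        · subst hij
          rw [hsymm]
          have h1 : LL Mj μ (Sum.inr ⟨j, k⟩) ^ s * LL Mj μ (Sum.inr ⟨j, l⟩) ^ (1 - s) =
              (Real.sqrt (μ j))⁻¹ * (Real.sqrt (μ j))⁻¹ := by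
            change (μ j)⁻¹ ^ s * (μ j)⁻¹ ^ (1 - s) = _
            rw [← Real.rpow_add (inv_pos.mpr (hμ0 j)), ← mul_inv, Real.mul_self_sqrt (hμ0 j).le]
            simp
          rw [h1]
          simp only [T, CC, Matrix.fromBlocks_apply₂₂, Matrix.blockDiagonal'_apply_eq,
            Matrix.smul_apply, Matrix.submatrix_apply, smul_eq_mul, Matrix.transpose_apply,
            Equiv.sumComm_apply, Sum.swap_inr]
          push_cast
          ring
        · rw [hzero (Sum.inr ⟨j, k⟩) (Sum.inr ⟨i, l⟩)
            (fun h => hij (hmono.injective (inv_injective h)))]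
          simp [CC, Matrix.blockDiagonal'_apply_ne _ _ _ hij]
  · rintro ⟨T, hT, hΨ⟩
    have hΨ' : Ψ = kmap (XX V) (CC μ T) := by
      ext1 A
      rw [kmap_CC, hΨ]
    rw [isCP_iff, choi_sub, hΦ', hΨ', choi_kmap, choi_kmap, ← Matrix.sub_mul, ← Matrix.mul_sub,
      CC_sub]
    exact (CC_psd μ fun j => (hT j).2).conjTranspose_mul_mul_same _
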